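/- Let (Ω, F, p) be a probability space and M : Ω → M_d(ℂ) a random reduced dynamics operator with fixed invariant unit vector ψ_S, and suppose p({ω : M(ω) ∈ ℳ_(E)}) > 0. Let θ_n(ω̄) := M(ω_n)^* ⋯ M(ω_2)^* ψ(ω_1). Then there exists a set Ω_2 ⊆ Ω^{ℕ*} with ℙ(Ω_2) = 1 such that for every ω̄ ∈ Ω_2, lim_{N→∞} (1/N) Σ_{n=1}^N θ_n(ω̄) = θ, where θ := P_{1,E[M]}^* ψ_S and P_{1,E[M]} is the spectral projection of E[M] for the eigenvalue 1; moreover θ = lim_{n→∞} E[θ_n] = P_{1,E[M]}^* E[ψ]. -/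

import Mathlib

open scoped BigOperators
open MeasureTheory Filter ContinuousLinearMap

noncomputable section

abbrev Evec (d : ℕ) := EuclideanSpace ℂ (Fin d)
abbrev Op (d : ℕ) := Evec d →L[ℂ] Evec d

/-- `ketBra u v = |u⟩⟨v|`, the rank-one operator `x ↦ ⟪v, x⟫ • u`. -/
def ketBra {d : ℕ} (u v : Evec d) : Op d := (innerSL ℂ v).smulRight u

/-- The spectral projection for the eigenvalue `1`, as the limit of Cesàro averages. -/
def cesaroProj {d : ℕ} (A : Op d) : Op d :=
  limUnder atTop (fun N : ℕ => (N : ℂ)⁻¹ • ∑ k ∈ Finset.range N, A ^ k)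

/-- The class `ℳ_(E)`. -/
def mcalE {d : ℕ} (ψS : Evec d) (A : Op d) : Prop :=
  (∃ Nrm : Seminorm ℂ (Evec d), (∀ x, Nrm x = 0 → x = 0) ∧ ∀ x, Nrm (A x) ≤ Nrm x) ∧
  A ψS = ψS ∧
  spectrum ℂ A ∩ {z : ℂ | ‖z‖ = 1} = {1} ∧
  Module.finrank ℂ (Module.End.maxGenEigenspace (A : Evec d →ₗ[ℂ] Evec d) 1) = 1

/-- `ψ(ω) = P₁(ω)* ψ_S`. -/
def psiOf {d : ℕ} (ψS : Evec d) (A : Op d) : Evec d := adjoint (cesaroProj A) ψS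

/-- `Q(ω) = 1 - |ψ_S⟩⟨ψ(ω)|`. -/
def Qof {d : ℕ} (ψS : Evec d) (A : Op d) : Op d := 1 - ketBra ψS (psiOf ψS A)

/-- `M_Q(ω) = Q(ω) M(ω) Q(ω)`. -/
def MQof {d : ℕ} (ψS : Evec d) (A : Op d) : Op d := Qof ψS A * A * Qof ψS A

open scoped Topology

section Contractions

variable {d : ℕ}

/-- The contractions of a norm form a bounded set of operators. -/
lemma exists_opNorm_le_of_contraction (Nrm : Seminorm ℂ (Evec d)) (hNrm : ∀ x, Nrm x = 0 → x = 0) :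
    ∃ K : ℝ, 0 ≤ K ∧ ∀ B : Op d, (∀ x, Nrm (B x) ≤ Nrm x) → ‖B‖ ≤ K := by
  rcases subsingleton_or_nontrivial (Evec d) with h | h
  · refine ⟨0, le_rfl, fun B _ => ?_⟩
    rw [Subsingleton.elim B 0, norm_zero]
  obtain ⟨C, hC0, hC⟩ : ∃ C : ℝ, 0 ≤ C ∧ ∀ x, Nrm x ≤ C * ‖x‖ := by
    let b := EuclideanSpace.basisFun (Fin d) ℂ
    refine ⟨∑ i, Nrm (b i), Finset.sum_nonneg fun i _ => apply_nonneg _ _, fun x => ?_⟩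
    calc Nrm x = Nrm (∑ i, b.repr x i • b i) := by rw [b.sum_repr]
      _ ≤ ∑ i, Nrm (b.repr x i • b i) :=
        Finset.le_sum_of_subadditive Nrm (map_zero Nrm).le (map_add_le_add Nrm) _ _
      _ ≤ ∑ i, Nrm (b i) * ‖x‖ := by
          refine Finset.sum_le_sum fun i _ => ?_
          rw [map_smul_eq_mul, mul_comm]
          refine mul_le_mul_of_nonneg_left ?_ (apply_nonneg _ _)
          simpa using PiLp.norm_apply_le (b.repr x) i
      _ = (∑ i, Nrm (b i)) * ‖x‖ := by rw [Finset.sum_mul]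
  have hcont : Continuous Nrm := by
    refine (LipschitzWith.of_dist_le_mul (K := ⟨C, hC0⟩) fun x y => ?_).continuous
    rw [Real.dist_eq, dist_eq_norm]
    exact (abs_sub_map_le_sub Nrm x y).trans (hC _)
  obtain ⟨x₀, hx₀, hmin⟩ := (isCompact_sphere (0 : Evec d) 1).exists_isMinOn
    (NormedSpace.sphere_nonempty.2 zero_le_one) hcont.continuousOn
  set c := Nrm x₀
  have hc : 0 < c := by
    refine lt_of_le_of_ne (apply_nonneg _ _) fun h0 => ?_
    have : x₀ = 0 := hNrm _ h0.symm
    simp [this] at hx₀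
  have hlow : ∀ x, c * ‖x‖ ≤ Nrm x := fun x => by
    rcases eq_or_ne x 0 with rfl | hx
    · simp
    have hx' : 0 < ‖x‖ := norm_pos_iff.2 hx
    have hm : ((‖x‖ : ℂ)⁻¹ • x) ∈ Metric.sphere (0 : Evec d) 1 := by
      simp [norm_smul, hx'.ne']
    have h1 : c ≤ Nrm ((‖x‖ : ℂ)⁻¹ • x) := hmin hm
    rw [map_smul_eq_mul] at h1
    simp only [norm_inv, Complex.norm_real, norm_norm] at h1
    rwa [inv_mul_eq_div, le_div_iff₀ hx'] at h1
  refine ⟨C / c, by positivity, fun B hB => B.opNorm_le_bound (by positivity) fun x => ?_⟩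
  rw [div_mul_eq_mul_div, le_div_iff₀ hc, mul_comm]
  exact (hlow _).trans ((hB x).trans (hC x))

/-- Mean ergodic theorem for power-bounded operators in finite dimension. -/
lemma tendsto_cesaroProj {A : Op d} {K : ℝ} (hA : ∀ n : ℕ, ‖A ^ n‖ ≤ K) :
    Tendsto (fun N : ℕ => (N : ℂ)⁻¹ • ∑ k ∈ Finset.range N, A ^ k) atTop (𝓝 (cesaroProj A)) ∧
      A * cesaroProj A = cesaroProj A ∧ cesaroProj A * A = cesaroProj A := by
  set S : ℕ → Op d := fun N => (N : ℂ)⁻¹ • ∑ k ∈ Finset.range N, A ^ k with hS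
  have hK : 0 ≤ K := (norm_nonneg _).trans (hA 0)
  have : ProperSpace (Op d) := FiniteDimensional.proper ℂ _
  have hbd : ∀ N, S N ∈ Metric.closedBall (0 : Op d) K := fun N => by
    rw [mem_closedBall_zero_iff, hS]
    simp only [norm_smul, norm_inv, Complex.norm_natCast]
    rcases Nat.eq_zero_or_pos N with rfl | hN
    · simpa using hK
    rw [inv_mul_le_iff₀ (by positivity)]
    refine (norm_sum_le _ _).trans ((Finset.sum_le_sum fun k _ => hA k).trans ?_)
    simp
  have hcomm : ∀ N, A * S N = S N * A := fun N => by
    simp only [hS, mul_smul_comm, smul_mul_assoc, Finset.mul_sum, Finset.sum_mul, ← pow_succ,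
      ← pow_succ']
  have hdiff : Tendsto (fun N => A * S N - S N) atTop (𝓝 0) := by
    have hz : Tendsto (fun N : ℕ => (N : ℝ)⁻¹ * (K + K)) atTop (𝓝 0) := by
      simpa using (tendsto_inv_atTop_nhds_zero_nat (𝕜 := ℝ)).mul_const (K + K)
    refine squeeze_zero_norm (fun N => ?_) hz
    have : A * S N - S N = (N : ℂ)⁻¹ • (A ^ N - A ^ 0) := by
      rw [← Finset.sum_range_sub (fun k => A ^ k) N, Finset.sum_sub_distrib]
      simp only [hS, mul_smul_comm, Finset.mul_sum, ← pow_succ', smul_sub]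
    rw [this, norm_smul, norm_inv, Complex.norm_natCast]
    exact mul_le_mul_of_nonneg_left ((norm_sub_le _ _).trans (add_le_add (hA _) (hA _)))
      (by positivity)
  have hfix : ∀ P, MapClusterPt P atTop S → A * P = P ∧ P * A = P := by
    intro P hP
    have hPA : A * P = P := by
      have h1 : MapClusterPt (A * P - P) atTop (fun N => A * S N - S N) :=
        MapClusterPt.continuousAt_comp (f := fun X : Op d => A * X - X)
          (by fun_prop) hP
      have := (ClusterPt.mono h1 hdiff).neBot
      exact sub_eq_zero.1 (eq_of_nhds_neBot this)
    refine ⟨hPA, ?_⟩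
    have h2 : MapClusterPt (A * P - P * A) atTop (fun N => A * S N - S N * A) :=
      MapClusterPt.continuousAt_comp (f := fun X : Op d => A * X - X * A)
        (by fun_prop) hP
    have h3 : Tendsto (fun N => A * S N - S N * A) atTop (𝓝 0) := by
      simp [hcomm]
    have := (ClusterPt.mono h2 h3).neBot
    have h4 := sub_eq_zero.1 (eq_of_nhds_neBot this)
    rw [← h4, hPA]
  have habs : ∀ P : Op d, A * P = P → ∀ N : ℕ, 0 < N → S N * P = P := by
    intro P hP N hN
    have hk : ∀ k : ℕ, A ^ k * P = P := fun k => by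
      induction k with
      | zero => simp
      | succ k ih => rw [pow_succ, mul_assoc, hP, ih]
    have hN' : (N : ℂ) ≠ 0 := by exact_mod_cast hN.ne'
    simp [hS, smul_mul_assoc, Finset.sum_mul, hk, ← Nat.cast_smul_eq_nsmul ℂ, smul_smul, hN']
  have habs' : ∀ P : Op d, P * A = P → ∀ N : ℕ, 0 < N → P * S N = P := by
    intro P hP N hN
    have hk : ∀ k : ℕ, P * A ^ k = P := fun k => by
      induction k with
      | zero => simp
      | succ k ih => rw [pow_succ', ← mul_assoc, hP, ih]
    have hN' : (N : ℂ) ≠ 0 := by exact_mod_cast hN.ne'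
    simp [hS, mul_smul_comm, Finset.mul_sum, hk, ← Nat.cast_smul_eq_nsmul ℂ, smul_smul, hN']
  obtain ⟨P, -, hP⟩ := (isCompact_closedBall (0 : Op d) K).exists_mapClusterPt
    (f := atTop) (u := S) (Eventually.of_forall hbd |> fun h => tendsto_principal.2 h)
  have hlim : Tendsto S atTop (𝓝 P) := by
    refine (isCompact_closedBall (0 : Op d) K).tendsto_nhds_of_unique_mapClusterPt
      (Eventually.of_forall hbd) fun R _ hR => ?_
    have h1 : R * P = P := by
      have h1 : MapClusterPt (R * P) atTop (fun N => S N * P) :=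
        MapClusterPt.continuousAt_comp (f := fun X : Op d => X * P) (by fun_prop) hR
      have h2 : Tendsto (fun N => S N * P) atTop (𝓝 P) :=
        tendsto_const_nhds.congr' ((eventually_gt_atTop 0).mono fun N hN =>
          (habs P (hfix P hP).1 N hN).symm)
      exact eq_of_nhds_neBot (ClusterPt.mono h1 h2).neBot
    have h2 : R * P = R := by
      have h1 : MapClusterPt (R * P) atTop (fun N => R * S N) :=
        MapClusterPt.continuousAt_comp (f := fun X : Op d => R * X) (by fun_prop) hP
      have h2 : Tendsto (fun N => R * S N) atTop (𝓝 R) :=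
        tendsto_const_nhds.congr' ((eventually_gt_atTop 0).mono fun N hN =>
          (habs' R (hfix R hR).2 N hN).symm)
      exact eq_of_nhds_neBot (ClusterPt.mono h1 h2).neBot
    rw [← h2, h1]
  have : cesaroProj A = P := hlim.limUnder_eq
  rw [this]
  exact ⟨hlim, hfix P hP⟩

lemma cesaroProj_apply_of_fixed {A : Op d} {K : ℝ} (hA : ∀ n : ℕ, ‖A ^ n‖ ≤ K) {x : Evec d}
    (hx : A x = x) : cesaroProj A x = x := by
  have h1 : Tendsto (fun N : ℕ => ((N : ℂ)⁻¹ • ∑ k ∈ Finset.range N, A ^ k) x) atTop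
      (𝓝 (cesaroProj A x)) :=
    ((ContinuousLinearMap.apply ℂ (Evec d) x).continuous.tendsto _).comp (tendsto_cesaroProj hA).1
  have hk : ∀ k : ℕ, (A ^ k) x = x := fun k => by
    induction k with
    | zero => simp
    | succ k ih => rw [pow_succ, mul_apply_eq_comp, hx, ih]
  refine tendsto_nhds_unique h1 (tendsto_const_nhds.congr' ?_)
  filter_upwards [eventually_gt_atTop 0] with N hN
  have hN' : (N : ℂ) ≠ 0 := by exact_mod_cast hN.ne'
  simp [hk, ← Nat.cast_smul_eq_nsmul ℂ, smul_smul, hN']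

lemma norm_cesaroProj_le {A : Op d} {K : ℝ} (hA : ∀ n : ℕ, ‖A ^ n‖ ≤ K) : ‖cesaroProj A‖ ≤ K := by
  refine le_of_tendsto (tendsto_cesaroProj hA).1.norm ((eventually_gt_atTop 0).mono fun N hN => ?_)
  rw [norm_smul, norm_inv, Complex.norm_natCast, inv_mul_le_iff₀ (by exact_mod_cast hN)]
  refine (norm_sum_le _ _).trans ((Finset.sum_le_sum fun k _ => hA k).trans ?_)
  simp

lemma tendsto_pow_of_spectralRadius_lt_one {B : Type*} [NormedRing B] [NormedAlgebra ℂ B]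
    [CompleteSpace B] {a : B} (ha : spectralRadius ℂ a < 1) :
    Tendsto (fun n : ℕ => a ^ n) atTop (𝓝 0) := by
  obtain ⟨r, hr, hr1⟩ := ENNReal.lt_iff_exists_nnreal_btwn.1 ha
  have hr1' : (r : ℝ) < 1 := by exact_mod_cast hr1
  refine squeeze_zero_norm' ?_ (tendsto_pow_atTop_nhds_zero_of_lt_one r.2 hr1')
  filter_upwards [(spectrum.pow_norm_pow_one_div_tendsto_nhds_spectralRadius a).eventually_lt_const hr,
    eventually_gt_atTop 0] with n hn hn0
  rw [ENNReal.ofReal_lt_iff_lt_toReal (by positivity) ENNReal.coe_ne_top, ENNReal.coe_toReal] at hn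
  have h := pow_le_pow_left₀ (by positivity) hn.le n
  rwa [one_div, Real.rpow_inv_natCast_pow (norm_nonneg _) hn0.ne'] at h

lemma adjoint_pow (A : Op d) (n : ℕ) : adjoint A ^ n = adjoint (A ^ n) := by
  simp only [← star_eq_adjoint, star_pow]

/-- For `A ∈ ℳ_(E)`, the powers of `A*` tend to zero on the orthogonal complement of `ψ_S`. -/
lemma exists_norm_adjoint_pow_apply_le {ψS : Evec d} (hψS : ψS ≠ 0) {A : Op d} {K : ℝ}
    (hA : ∀ n : ℕ, ‖A ^ n‖ ≤ K) (hE : mcalE ψS A) {ε : ℝ} (hε : 0 < ε) :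
    ∃ k : ℕ, k ≠ 0 ∧ ∀ v, inner ℂ ψS v = 0 → ‖(adjoint A ^ k) v‖ ≤ ε * ‖v‖ := by
  obtain ⟨-, hfix, hspec, hdim⟩ := hE
  obtain ⟨-, hAP, hPA⟩ := tendsto_cesaroProj hA
  set P := cesaroProj A with hPdef
  have : Nontrivial (Evec d) := ⟨ψS, 0, hψS⟩
  have hfixP : ∀ x, A x = x → P x = x := fun x hx => cesaroProj_apply_of_fixed hA hx
  have hPP : P * P = P := by
    ext1 x
    exact hfixP _ (congrArg (fun B : Op d => B x) hAP)
  have hrange : ∀ x, ∃ c : ℂ, c • ψS = P x := fun x => by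
    have hmem : ∀ y, A y = y → y ∈ Module.End.maxGenEigenspace (A : Evec d →ₗ[ℂ] Evec d) 1 := by
      intro y hy
      refine (Module.End.mem_maxGenEigenspace _ _ _).2 ⟨1, ?_⟩
      simp [hy]
    obtain ⟨c, hc⟩ := (finrank_eq_one_iff_of_nonzero'
      (⟨ψS, hmem _ hfix⟩ : Module.End.maxGenEigenspace (A : Evec d →ₗ[ℂ] Evec d) 1)
      (by simpa using hψS)).1 hdim ⟨P x, hmem _ (congrArg (fun B : Op d => B x) hAP)⟩
    exact ⟨c, congrArg Subtype.val hc⟩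
  have hApow : ∀ n : ℕ, A ^ n * P = P := fun n => by
    induction n with
    | zero => simp
    | succ n ih => rw [pow_succ, mul_assoc, hAP, ih]
  have hpow : ∀ n : ℕ, (A - P) ^ (n + 1) = A ^ (n + 1) - P := fun n => by
    induction n with
    | zero => simp
    | succ n ih =>
      rw [pow_succ, ih, sub_mul, mul_sub, mul_sub, ← pow_succ, hApow, hPA, hPP]
      abel
  have hrad : spectralRadius ℂ (A - P) < 1 := by
    refine spectrum.spectralRadius_lt_of_forall_lt (r := 1) _ fun z hz => ?_
    by_contra hz1
    have hz1 : 1 ≤ ‖z‖ := by simpa [← NNReal.coe_le_coe] using not_lt.1 hz1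
    have hz0 : z ≠ 0 := by
      rintro rfl
      simp at hz1
      linarith
    rw [ContinuousLinearMap.spectrum_eq] at hz
    obtain ⟨v, hv⟩ := (Module.End.hasEigenvalue_iff_mem_spectrum.2 hz).exists_hasEigenvector
    have hv1 : A v - P v = z • v := hv.apply_eq_smul
    have hv0 : v ≠ 0 := hv.2
    have hPv : P v = 0 := by
      have h1 : P (A v - P v) = 0 := by
        rw [map_sub]
        have h2 : P (A v) = P v := congrArg (fun B : Op d => B v) hPA
        have h3 : P (P v) = P v := congrArg (fun B : Op d => B v) hPP
        rw [h2, h3, sub_self]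
      rw [hv1, map_smul] at h1
      exact (smul_eq_zero.1 h1).resolve_left hz0
    rw [hPv, sub_zero] at hv1
    have hpv : ∀ n : ℕ, (A ^ n) v = z ^ n • v := fun n => by
      induction n with
      | zero => simp
      | succ n ih => rw [pow_succ, mul_apply_eq_comp, hv1, map_smul, ih, smul_smul, pow_succ']
    have hz2 : ‖z‖ = 1 := by
      refine le_antisymm (not_lt.1 fun hlt => ?_) hz1
      obtain ⟨n, hn⟩ := pow_unbounded_of_one_lt K hlt
      have h1 := (A ^ n).le_of_opNorm_le (hA n) v
      rw [hpv, norm_smul, norm_pow] at h1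
      exact absurd (le_of_mul_le_mul_right h1 (norm_pos_iff.2 hv0)) (not_le.2 hn)
    have hz3 : z ∈ spectrum ℂ A := by
      rw [ContinuousLinearMap.spectrum_eq]
      refine Module.End.HasEigenvalue.mem_spectrum
        (Module.End.hasEigenvalue_of_hasEigenvector (x := v) ⟨?_, hv0⟩)
      exact Module.End.mem_eigenspace_iff.2 hv1
    have hz4 : z = 1 := by
      have : z ∈ ({1} : Set ℂ) := hspec ▸ ⟨hz3, hz2⟩
      exact this
    rw [hz4, one_smul] at hv1
    exact hv0 ((hfixP v hv1).symm.trans hPv)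
  have hlim := ((tendsto_pow_of_spectralRadius_lt_one hrad).comp (tendsto_add_atTop_nat 1)).norm
  rw [norm_zero] at hlim
  obtain ⟨n, hn⟩ := (hlim.eventually_le_const hε).exists
  refine ⟨n + 1, n.succ_ne_zero, fun v hv => ?_⟩
  have hPv : adjoint P v = 0 := by
    refine ext_inner_left ℂ fun x => ?_
    rw [adjoint_inner_right, inner_zero_right]
    obtain ⟨c, hc⟩ := hrange x
    rw [← hc, inner_smul_left, hv, mul_zero]
  have h1 : A ^ (n + 1) = (A - P) ^ (n + 1) + P := by rw [hpow]; abel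
  rw [adjoint_pow, h1, map_add, add_apply, hPv, add_zero]
  refine le_of_opNorm_le _ ?_ v
  rw [LinearIsometryEquiv.norm_map]
  exact hn

/-- The supremum of `‖B v‖` over the operators `B` of a set. -/
def supNorm (S : Set (Op d)) (v : Evec d) : ℝ := ⨆ B : S, ‖(B : Op d) v‖

lemma supNorm_nonneg (S : Set (Op d)) (v : Evec d) : 0 ≤ supNorm S v :=
  Real.iSup_nonneg fun _ => norm_nonneg _

lemma norm_apply_le_supNorm {S : Set (Op d)} {K : ℝ} (hS : ∀ B ∈ S, ‖B‖ ≤ K) {B : Op d}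
    (hB : B ∈ S) (v : Evec d) : ‖B v‖ ≤ supNorm S v :=
  le_ciSup (f := fun B : S => ‖(B : Op d) v‖)
    ⟨K * ‖v‖, by rintro _ ⟨C, rfl⟩; exact le_of_opNorm_le _ (hS _ C.2) v⟩ ⟨B, hB⟩

lemma supNorm_le {S : Set (Op d)} {v : Evec d} {a : ℝ} (ha : 0 ≤ a) (h : ∀ B ∈ S, ‖B v‖ ≤ a) :
    supNorm S v ≤ a :=
  Real.iSup_le (fun B => h B B.2) ha

lemma supNorm_le_mul_norm {S : Set (Op d)} {K : ℝ} (hK : 0 ≤ K) (hS : ∀ B ∈ S, ‖B‖ ≤ K)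
    (v : Evec d) : supNorm S v ≤ K * ‖v‖ :=
  supNorm_le (by positivity) fun B hB => le_of_opNorm_le _ (hS B hB) v

lemma supNorm_add_le {S : Set (Op d)} {K : ℝ} (hS : ∀ B ∈ S, ‖B‖ ≤ K) (u v : Evec d) :
    supNorm S (u + v) ≤ supNorm S u + supNorm S v := by
  refine supNorm_le (add_nonneg (supNorm_nonneg _ _) (supNorm_nonneg _ _)) fun B hB => ?_
  rw [map_add]
  exact (norm_add_le _ _).trans
    (add_le_add (norm_apply_le_supNorm hS hB u) (norm_apply_le_supNorm hS hB v))

end Contractions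

section AveragedDynamics

variable {d : ℕ} {Ω : Type*} [MeasurableSpace Ω] {p : Measure Ω} [IsProbabilityMeasure p]
  {L : Ω → Op d} {S : Submonoid (Op d)} {K : ℝ}

lemma integrable_of_mem_submonoid (hLm : Measurable L) (hS : ∀ B ∈ S, ‖B‖ ≤ K)
    (hL : ∀ ω, L ω ∈ S) : Integrable L p :=
  Integrable.of_bound hLm.aestronglyMeasurable K (ae_of_all _ fun ω => hS _ (hL ω))

lemma supNorm_setIntegral_apply_le (hLm : Measurable L) (hS : ∀ B ∈ S, ‖B‖ ≤ K)
    (hL : ∀ ω, L ω ∈ S) (s : Set Ω) (v : Evec d) :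
    supNorm S ((∫ ω in s, L ω ∂p) v) ≤ p.real s * supNorm S v := by
  refine supNorm_le (mul_nonneg measureReal_nonneg (supNorm_nonneg _ _)) fun B hB => ?_
  have hint : Integrable L (p.restrict s) := (integrable_of_mem_submonoid hLm hS hL).restrict
  rw [ContinuousLinearMap.integral_apply hint, ← ContinuousLinearMap.integral_comp_comm B
    (hint.apply_continuousLinearMap v), mul_comm]
  refine norm_setIntegral_le_of_norm_le_const (measure_lt_top p s) fun ω _ => ?_
  exact norm_apply_le_supNorm hS (S.mul_mem hB (hL ω)) v

lemma supNorm_integral_apply_le (hLm : Measurable L) (hS : ∀ B ∈ S, ‖B‖ ≤ K)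
    (hL : ∀ ω, L ω ∈ S) (v : Evec d) :
    supNorm S ((∫ ω, L ω ∂p) v) ≤ supNorm S v := by
  simpa using supNorm_setIntegral_apply_le (p := p) hLm hS hL Set.univ v

lemma supNorm_integral_pow_apply_le (hLm : Measurable L) (hS : ∀ B ∈ S, ‖B‖ ≤ K)
    (hL : ∀ ω, L ω ∈ S) (n : ℕ) (v : Evec d) :
    supNorm S (((∫ ω, L ω ∂p) ^ n) v) ≤ supNorm S v := by
  induction n with
  | zero => simp
  | succ n ih =>
    rw [pow_succ', mul_apply_eq_comp]
    exact (supNorm_integral_apply_le hLm hS hL _).trans ih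

lemma norm_integral_pow_le (hLm : Measurable L) (hS : ∀ B ∈ S, ‖B‖ ≤ K)
    (hL : ∀ ω, L ω ∈ S) (n : ℕ) : ‖(∫ ω, L ω ∂p) ^ n‖ ≤ K := by
  have hK : 0 ≤ K := (norm_nonneg _).trans (hS 1 S.one_mem)
  refine opNorm_le_bound _ hK fun v => ?_
  exact (norm_apply_le_supNorm hS S.one_mem _).trans
    ((supNorm_integral_pow_apply_le hLm hS hL n v).trans (supNorm_le_mul_norm hK hS v))

lemma supNorm_integral_pow_sub_le (hLm : Measurable L) (hS : ∀ B ∈ S, ‖B‖ ≤ K)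
    (hL : ∀ ω, L ω ∈ S) {U : Set Ω} (hU : MeasurableSet U) (n : ℕ) (v : Evec d) :
    supNorm S (((∫ ω, L ω ∂p) ^ n - (∫ ω in U, L ω ∂p) ^ n) v) ≤
      (1 - p.real U ^ n) * supNorm S v := by
  set T := ∫ ω, L ω ∂p with hT
  set X := ∫ ω in U, L ω ∂p with hX
  set c := p.real U with hc
  have hc0 : 0 ≤ c := measureReal_nonneg
  have hc1 : c ≤ 1 := measureReal_le_one
  have hTX : T - X = ∫ ω in Uᶜ, L ω ∂p := by
    rw [hT, hX, ← integral_add_compl hU (integrable_of_mem_submonoid hLm hS hL),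
      add_sub_cancel_left]
  have hXn : ∀ n : ℕ, supNorm S ((X ^ n) v) ≤ c ^ n * supNorm S v := fun n => by
    induction n with
    | zero => simp
    | succ n ih =>
      rw [pow_succ', mul_apply_eq_comp, pow_succ', mul_assoc]
      exact (supNorm_setIntegral_apply_le hLm hS hL U _).trans
        (mul_le_mul_of_nonneg_left ih hc0)
  induction n with
  | zero => simpa using supNorm_le_mul_norm (norm_nonneg _ |>.trans (hS 1 S.one_mem)) hS (0 : Evec d)
  | succ n ih =>
    have h1 : T ^ (n + 1) - X ^ (n + 1) = T * (T ^ n - X ^ n) + (T - X) * X ^ n := by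
      rw [pow_succ', pow_succ', mul_sub, sub_mul]
      abel
    have h2 : supNorm S ((T - X) ((X ^ n) v)) ≤ (1 - c) * (c ^ n * supNorm S v) := by
      rw [hTX]
      refine (supNorm_setIntegral_apply_le hLm hS hL Uᶜ _).trans ?_
      rw [probReal_compl_eq_one_sub hU]
      exact mul_le_mul_of_nonneg_left (hXn n) (by linarith)
    have h3 := (supNorm_integral_apply_le (p := p) hLm hS hL ((T ^ n - X ^ n) v)).trans ih
    calc supNorm S ((T ^ (n + 1) - X ^ (n + 1)) v)
        ≤ supNorm S (T ((T ^ n - X ^ n) v)) + supNorm S ((T - X) ((X ^ n) v)) := by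
          rw [h1]
          exact supNorm_add_le hS _ _
      _ ≤ (1 - c ^ n) * supNorm S v + (1 - c) * (c ^ n * supNorm S v) := add_le_add h3 h2
      _ = (1 - c ^ (n + 1)) * supNorm S v := by ring

/-- If some operator in the support of the law of `L` has powers that vanish asymptotically on `W`,
then so does the mean of `L`. -/
lemma tendsto_integral_pow_apply (hLm : Measurable L) (hS : ∀ B ∈ S, ‖B‖ ≤ K)
    (hL : ∀ ω, L ω ∈ S) {W : Set (Evec d)} (hW : ∀ v ∈ W, (∫ ω, L ω ∂p) v ∈ W) {L₀ : Op d}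
    (hL₀ : ∀ ε : ℝ, 0 < ε → ∃ k : ℕ, k ≠ 0 ∧ ∀ v ∈ W, ‖(L₀ ^ k) v‖ ≤ ε * ‖v‖)
    (hpos : ∀ U ∈ 𝓝 L₀, 0 < p (L ⁻¹' U)) {v : Evec d} (hv : v ∈ W) :
    Tendsto (fun n : ℕ => ((∫ ω, L ω ∂p) ^ n) v) atTop (𝓝 0) := by
  have hK : 0 ≤ K := (norm_nonneg _).trans (hS 1 S.one_mem)
  set T := ∫ ω, L ω ∂p with hT
  set ε : ℝ := (4 * (K + 1))⁻¹ with hε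
  have hε0 : 0 < ε := by positivity
  obtain ⟨k, hk0, hk⟩ := hL₀ ε hε0
  obtain ⟨δ, hδ0, hδ⟩ := Metric.nhds_basis_closedBall.mem_iff.1
    ((continuous_pow k).continuousAt.preimage_mem_nhds (Metric.closedBall_mem_nhds (L₀ ^ k) hε0))
  set U := L ⁻¹' Metric.closedBall L₀ δ with hUdef
  have hU : MeasurableSet U := hLm Metric.isClosed_closedBall.measurableSet
  have hUpos : 0 < p U := hpos _ (Metric.closedBall_mem_nhds L₀ hδ0)
  set c := p.real U with hc
  have hc0 : 0 < c := ENNReal.toReal_pos hUpos.ne' (measure_ne_top p U)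
  have hc1 : c ≤ 1 := measureReal_le_one
  set X := ∫ ω in U, L ω ∂p with hX
  set B := ⨍ ω in U, L ω ∂p with hB
  have hBmem : B ∈ Metric.closedBall L₀ δ :=
    (convex_closedBall L₀ δ).set_average_mem Metric.isClosed_closedBall hUpos.ne'
      (measure_ne_top p U) ((ae_restrict_mem hU).mono fun ω h => h)
      (integrable_of_mem_submonoid hLm hS hL).integrableOn
  have hXB : X = (c : ℂ) • B := by
    have h1 : X = c • B := by
      rw [hB, setAverage_eq, smul_smul, mul_inv_cancel₀ hc0.ne', one_smul]
    rw [h1]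
    ext w i
    simp
  have hBk : ‖B ^ k - L₀ ^ k‖ ≤ ε := by
    rw [← dist_eq_norm]
    exact hδ hBmem
  have hXk : ∀ w ∈ W, supNorm S ((X ^ k) w) ≤ c ^ k / 2 * supNorm S w := fun w hw => by
    have h1 : ‖w‖ ≤ supNorm S w := norm_apply_le_supNorm hS S.one_mem w
    have h2 : ‖(B ^ k) w‖ ≤ (ε + ε) * ‖w‖ := by
      have : (B ^ k) w = (B ^ k - L₀ ^ k) w + (L₀ ^ k) w := by simp
      rw [this, add_mul]
      exact (norm_add_le _ _).trans (add_le_add (le_of_opNorm_le _ hBk w) (hk w hw))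
    have h3 : ‖(X ^ k) w‖ ≤ c ^ k * ((ε + ε) * ‖w‖) := by
      rw [hXB, smul_pow, smul_apply, norm_smul, norm_pow, Complex.norm_real, Real.norm_of_nonneg hc0.le]
      exact mul_le_mul_of_nonneg_left h2 (by positivity)
    have h4 : K * (ε + ε) ≤ 1 / 2 := by
      rw [hε]
      field_simp
      linarith
    calc supNorm S ((X ^ k) w) ≤ K * ‖(X ^ k) w‖ := supNorm_le_mul_norm hK hS _
      _ ≤ K * (c ^ k * ((ε + ε) * ‖w‖)) := mul_le_mul_of_nonneg_left h3 hK
      _ = c ^ k * ((K * (ε + ε)) * ‖w‖) := by ring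
      _ ≤ c ^ k * (1 / 2 * supNorm S w) := by gcongr
      _ = c ^ k / 2 * supNorm S w := by ring
  set r : ℝ := 1 - c ^ k / 2 with hr
  have hck0 : 0 < c ^ k := by positivity
  have hck1 : c ^ k ≤ 1 := pow_le_one₀ hc0.le hc1
  have hTk : ∀ w ∈ W, supNorm S ((T ^ k) w) ≤ r * supNorm S w := fun w hw => by
    have h1 : (T ^ k) w = (T ^ k - X ^ k) w + (X ^ k) w := by simp
    have h2 := supNorm_integral_pow_sub_le (p := p) hLm hS hL hU k w
    rw [h1]
    refine (supNorm_add_le hS _ _).trans ((add_le_add h2 (hXk w hw)).trans_eq ?_)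
    rw [hr]
    ring
  have hTW : ∀ n : ℕ, (T ^ n) v ∈ W := fun n => by
    induction n with
    | zero => simpa using hv
    | succ n ih =>
      rw [pow_succ', mul_apply_eq_comp]
      exact hW _ ih
  have hTkj : ∀ j : ℕ, supNorm S ((T ^ (k * j)) v) ≤ r ^ j * supNorm S v := fun j => by
    induction j with
    | zero => simp
    | succ j ih =>
      rw [mul_add, mul_one, add_comm, pow_add, mul_apply_eq_comp, pow_succ', mul_assoc]
      exact (hTk _ (hTW _)).trans (mul_le_mul_of_nonneg_left ih (by linarith))
  have hbound : ∀ n : ℕ, ‖(T ^ n) v‖ ≤ r ^ (n / k) * supNorm S v := fun n => by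
    have h1 : ‖(T ^ n) v‖ ≤ supNorm S ((T ^ n) v) := norm_apply_le_supNorm hS S.one_mem _
    refine h1.trans (le_trans ?_ (hTkj (n / k)))
    conv_lhs => rw [← Nat.mod_add_div n k, pow_add, mul_apply_eq_comp]
    exact supNorm_integral_pow_apply_le hLm hS hL _ _
  refine squeeze_zero_norm hbound ?_
  have h1 := ((tendsto_pow_atTop_nhds_zero_of_lt_one (by linarith : 0 ≤ r) (by linarith)).comp
    (Nat.tendsto_div_const_atTop hk0)).mul_const (supNorm S v)
  simpa using h1

end AveragedDynamics

section ProductSpace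

variable {Ω : Type*} [MeasurableSpace Ω] {p : Measure Ω} [IsProbabilityMeasure p]

/-- A measure on sequences with product marginals is the infinite product measure. -/
lemma eq_infinitePi_of_map_fin {P : Measure (ℕ → Ω)}
    (hP : ∀ n : ℕ, P.map (fun x (i : Fin n) => x i) = Measure.pi fun _ : Fin n => p) :
    P = Measure.infinitePi fun _ : ℕ => p := by
  refine Measure.eq_infinitePi _ fun s t ht => ?_
  obtain ⟨n, hn⟩ := s.exists_nat_subset_range
  have hpre : Set.pi (s : Set ℕ) t = (fun (x : ℕ → Ω) (i : Fin n) => x i) ⁻¹'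
      Set.univ.pi fun i : Fin n => if (i : ℕ) ∈ s then t i else Set.univ := by
    ext x
    simp only [Set.mem_pi, Finset.mem_coe, Set.mem_preimage, Set.mem_univ, true_imp_iff]
    refine ⟨fun h i => ?_, fun h i hi => ?_⟩
    · split_ifs with hi
      · exact h _ hi
      · exact Set.mem_univ _
    · simpa [hi] using h ⟨i, Finset.mem_range.1 (hn hi)⟩
  have hmeas : MeasurableSet
      (Set.univ.pi fun i : Fin n => if (i : ℕ) ∈ s then t i else Set.univ) := by
    refine MeasurableSet.univ_pi fun i => ?_
    split_ifs
    · exact ht _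
    · exact MeasurableSet.univ
  rw [hpre, ← Measure.map_apply (by fun_prop) hmeas, hP, Measure.pi_pi,
    Fin.prod_univ_eq_prod_range (fun i => p (if i ∈ s then t i else Set.univ)) n,
    ← Finset.prod_subset hn]
  · exact Finset.prod_congr rfl fun i hi => by rw [if_pos hi]
  · intro i _ hi
    rw [if_neg hi, measure_univ]

/-- Resampling one coordinate preserves the infinite product measure. -/
lemma map_update_infinitePi_prod (n : ℕ) :
    ((Measure.infinitePi fun _ : ℕ => p).prod p).map
      (fun z : (ℕ → Ω) × Ω => Function.update z.1 n z.2) = Measure.infinitePi fun _ : ℕ => p := by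
  refine Measure.eq_infinitePi _ fun s t ht => ?_
  have hpre : (fun z : (ℕ → Ω) × Ω => Function.update z.1 n z.2) ⁻¹' Set.pi (s : Set ℕ) t =
      Set.pi (s.erase n : Finset ℕ) t ×ˢ (if n ∈ s then t n else Set.univ) := by
    ext ⟨x, ω⟩
    simp only [Set.mem_preimage, Set.mem_pi, Finset.mem_coe, Set.mem_prod, Finset.mem_erase]
    refine ⟨fun h => ⟨fun i hi => ?_, ?_⟩, fun h i hi => ?_⟩
    · simpa [hi.1] using h i hi.2
    · split_ifs with hn
      · simpa using h n hn
      · exact Set.mem_univ _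
    · rcases eq_or_ne i n with rfl | hin
      · simpa [hi] using h.2
      · simpa [hin] using h.1 i ⟨hin, hi⟩
  rw [Measure.map_apply measurable_update' (MeasurableSet.pi s.countable_toSet fun i _ => ht i),
    hpre, Measure.prod_prod, Measure.infinitePi_pi _ fun i _ => ht i]
  split_ifs with hn
  · rw [Finset.prod_erase_mul s _ hn]
  · rw [measure_univ, mul_one, Finset.erase_eq_of_notMem hn]

lemma integral_infinitePi_eq_integral_update {F : Type*} [NormedAddCommGroup F] [NormedSpace ℝ F]
    (n : ℕ) {H : (ℕ → Ω) → F} (hH : Integrable H (Measure.infinitePi fun _ : ℕ => p)) :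
    ∫ x, H x ∂(Measure.infinitePi fun _ : ℕ => p) =
      ∫ x, ∫ ω, H (Function.update x n ω) ∂p ∂(Measure.infinitePi fun _ : ℕ => p) := by
  have hmap := map_update_infinitePi_prod (p := p) n
  have hH' := hH
  rw [← hmap] at hH'
  conv_lhs => rw [← hmap]
  rw [integral_map measurable_update'.aemeasurable hH'.aestronglyMeasurable]
  exact integral_prod _ (hH'.comp_measurable measurable_update')

end ProductSpace

section LawOfLargeNumbers

/-- Strong law for bounded sequences whose partial sums have second moments of linear growth. -/
lemma ae_tendsto_average_zero {X F : Type*} [MeasurableSpace X] {μ : Measure X}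
    [IsProbabilityMeasure μ] [NormedAddCommGroup F] [NormedSpace ℝ F] {D : ℕ → X → F} {C : ℝ}
    (hDm : ∀ n, AEStronglyMeasurable (D n) μ) (hD : ∀ n x, ‖D n x‖ ≤ C)
    (hvar : ∀ N : ℕ, ∫ x, ‖∑ n ∈ Finset.range N, D n x‖ ^ 2 ∂μ ≤ C ^ 2 * N) :
    ∀ᵐ x ∂μ, Tendsto (fun N : ℕ => (N : ℝ)⁻¹ • ∑ n ∈ Finset.range N, D n x) atTop (𝓝 0) := by
  set R : ℕ → X → F := fun N x => ∑ n ∈ Finset.range N, D n x with hR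
  have hRm : ∀ N, AEStronglyMeasurable (R N) μ := fun N =>
    Finset.aestronglyMeasurable_fun_sum _ fun n _ => hDm n
  have hRdiff : ∀ M N : ℕ, M ≤ N → ∀ x, ‖R N x - R M x‖ ≤ (N - M) * C := fun M N hMN x => by
    simp only [hR]
    rw [← Finset.sum_Ico_eq_sub _ hMN]
    refine (norm_sum_le_of_le _ fun n _ => hD n x).trans_eq ?_
    rw [Finset.sum_const, Nat.card_Ico, nsmul_eq_mul, Nat.cast_sub hMN]
  have hRint : ∀ N, Integrable (fun x => ‖R N x‖ ^ 2) μ := fun N => by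
    refine Integrable.of_bound ((hRm N).norm.pow 2) ((N * C) ^ 2) (ae_of_all _ fun x => ?_)
    have h := hRdiff 0 N N.zero_le x
    simp only [hR, Finset.range_zero, Finset.sum_empty, sub_zero, Nat.cast_zero] at h
    rw [norm_pow, norm_norm]
    exact pow_le_pow_left₀ (norm_nonneg _) h 2
  set f : ℕ → X → ENNReal := fun j x => ENNReal.ofReal ((((j : ℝ) ^ 2)⁻¹ * ‖R (j ^ 2) x‖) ^ 2)
    with hf
  have hfm : ∀ j, AEMeasurable (f j) μ := fun j =>
    (((hRm _).norm.aemeasurable.const_mul _).pow_const 2).ennreal_ofReal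
  have hfint : ∀ j, ∫⁻ x, f j x ∂μ ≤ ENNReal.ofReal (C ^ 2 * (1 / (j : ℝ) ^ 2)) := fun j => by
    have h1 : Integrable (fun x => ((((j : ℝ) ^ 2)⁻¹ * ‖R (j ^ 2) x‖) ^ 2)) μ := by
      simp only [mul_pow]
      exact (hRint _).const_mul _
    rw [hf, ← ofReal_integral_eq_lintegral_ofReal h1 (ae_of_all _ fun x => sq_nonneg _)]
    refine ENNReal.ofReal_le_ofReal ?_
    simp only [mul_pow, integral_const_mul]
    refine (mul_le_mul_of_nonneg_left (hvar (j ^ 2)) (by positivity)).trans_eq ?_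
    rcases eq_or_ne j 0 with rfl | hj
    · simp
    have : (j : ℝ) ≠ 0 := by exact_mod_cast hj
    push_cast
    field_simp
  have hsum : ∫⁻ x, ∑' j, f j x ∂μ ≠ ⊤ := by
    rw [lintegral_tsum hfm]
    refine ne_top_of_le_ne_top ?_ (ENNReal.tsum_le_tsum hfint)
    exact ((Real.summable_one_div_nat_pow.2 one_lt_two).mul_left _).tsum_ofReal_ne_top
  filter_upwards [ae_lt_top' (AEMeasurable.tsum hfm) hsum] with x hx
  have hsq : Tendsto (fun j : ℕ => ((j : ℝ) ^ 2)⁻¹ * ‖R (j ^ 2) x‖) atTop (𝓝 0) := by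
    have h1 := (ENNReal.tendsto_toReal ENNReal.zero_ne_top).comp
      (ENNReal.tendsto_atTop_zero_of_tsum_ne_top hx.ne)
    have h2 := h1.sqrt
    simp only [ENNReal.toReal_zero, Real.sqrt_zero] at h2
    refine h2.congr fun j => ?_
    simp only [Function.comp_apply, hf]
    rw [ENNReal.toReal_ofReal (sq_nonneg _), Real.sqrt_sq (by positivity)]
  have hsqrt : Tendsto Nat.sqrt atTop atTop := by
    refine tendsto_atTop.2 fun b => (eventually_ge_atTop (b ^ 2)).mono fun n hn => ?_
    exact Nat.le_sqrt'.2 hn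
  have hC : 0 ≤ C := (norm_nonneg _).trans (hD 0 x)
  have hlim : Tendsto (fun N : ℕ => ((N.sqrt : ℝ) ^ 2)⁻¹ * ‖R (N.sqrt ^ 2) x‖ +
      2 * C * (N.sqrt : ℝ)⁻¹) atTop (𝓝 0) := by
    have h1 := ((tendsto_inv_atTop_nhds_zero_nat (𝕜 := ℝ)).comp hsqrt).const_mul (2 * C)
    have h2 := (hsq.comp hsqrt).add h1
    simpa using h2
  refine squeeze_zero_norm' ?_ hlim
  filter_upwards [eventually_ge_atTop 1] with N hN
  set j := N.sqrt with hj
  have hj1 : 1 ≤ j := Nat.le_sqrt'.2 (by simpa using hN)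
  have hjN : j ^ 2 ≤ N := Nat.sqrt_le' N
  have hNj : N ≤ j ^ 2 + 2 * j := by
    have := Nat.lt_succ_sqrt' N
    rw [← hj] at this
    nlinarith
  have hjr : (0 : ℝ) < j := by exact_mod_cast hj1
  have hjN' : (j : ℝ) ^ 2 ≤ N := by exact_mod_cast hjN
  have hNj' : (N : ℝ) - (j : ℝ) ^ 2 ≤ 2 * j := by
    have : (N : ℝ) ≤ (j : ℝ) ^ 2 + 2 * j := by exact_mod_cast hNj
    linarith
  have h1 : ‖R N x‖ ≤ ‖R (j ^ 2) x‖ + 2 * j * C := by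
    have h2 := hRdiff _ _ hjN x
    push_cast at h2
    calc ‖R N x‖ = ‖R (j ^ 2) x + (R N x - R (j ^ 2) x)‖ := by rw [add_sub_cancel]
      _ ≤ ‖R (j ^ 2) x‖ + ‖R N x - R (j ^ 2) x‖ := norm_add_le _ _
      _ ≤ _ := by
        gcongr
        exact h2.trans (mul_le_mul_of_nonneg_right hNj' hC)
  rw [norm_smul, norm_inv, Real.norm_natCast]
  calc (N : ℝ)⁻¹ * ‖R N x‖ ≤ ((j : ℝ) ^ 2)⁻¹ * (‖R (j ^ 2) x‖ + 2 * j * C) := by gcongr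
    _ = ((j : ℝ) ^ 2)⁻¹ * ‖R (j ^ 2) x‖ + 2 * C * (j : ℝ)⁻¹ := by
      field_simp

end LawOfLargeNumbers

section RandomProducts

lemma integral_adjoint {d : ℕ} {Ω : Type*} [MeasurableSpace Ω] {p : Measure Ω} {M : Ω → Op d}
    (hM : Integrable M p) :
    ∫ ω, adjoint (M ω) ∂p = adjoint (∫ ω, M ω ∂p) := by
  have h := ((starL' ℝ : Op d ≃L[ℝ] Op d) : Op d →L[ℝ] Op d).integral_comp_comm hM
  simpa [star_eq_adjoint] using h

variable {d : ℕ} {Ω : Type*} [MeasurableSpace Ω] {p : Measure Ω} [IsProbabilityMeasure p]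
  {L : Ω → Op d} {S : Submonoid (Op d)} {K C : ℝ} {x : ℕ → (ℕ → Ω) → Evec d}

lemma integral_apply_sub_eq_zero (hL : Integrable L p) (v : Evec d) :
    ∫ ω, (L ω v - (∫ ω, L ω ∂p) v) ∂p = 0 := by
  rw [integral_sub (hL.apply_continuousLinearMap v) (integrable_const _),
    ContinuousLinearMap.integral_apply hL]
  simp

lemma integrable_of_measurable_of_norm_le {X : Type*} [MeasurableSpace X] {μ : Measure X}
    [IsFiniteMeasure μ] {f : X → Evec d} (hf : Measurable f) (hC : ∀ y, ‖f y‖ ≤ C) :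
    Integrable f μ :=
  Integrable.of_bound hf.aestronglyMeasurable C (ae_of_all _ hC)

lemma measurable_apply_of_measurable {X : Type*} [MeasurableSpace X] {A : X → Op d}
    {f : X → Evec d} (hA : Measurable A) (hf : Measurable f) : Measurable fun y => A y (f y) :=
  (isBoundedBilinearMap_apply (𝕜 := ℂ) (E := Evec d) (F := Evec d)).continuous.measurable.comp
    (hA.prodMk hf)

/-- The fluctuations `L(ω_{n+1}) x_n - E[L] x_n` of a bounded random product average to zero. -/
lemma ae_tendsto_average_noise (hLm : Measurable L) (hS : ∀ B ∈ S, ‖B‖ ≤ K) (hL : ∀ ω, L ω ∈ S)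
    (hxm : ∀ n, Measurable (x n)) (hxC : ∀ n ωb, ‖x n ωb‖ ≤ C)
    (hxu : ∀ n m, n < m → ∀ ωb ω, x n (Function.update ωb m ω) = x n ωb) :
    ∀ᵐ ωb ∂(Measure.infinitePi fun _ : ℕ => p),
      Tendsto (fun N : ℕ => (N : ℝ)⁻¹ • ∑ n ∈ Finset.range N,
        (L (ωb (n + 1)) (x n ωb) - (∫ ω, L ω ∂p) (x n ωb))) atTop (𝓝 0) := by
  set μ := Measure.infinitePi fun _ : ℕ => p with hμ
  set T := ∫ ω, L ω ∂p with hT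
  set D : ℕ → (ℕ → Ω) → Evec d := fun n ωb => L (ωb (n + 1)) (x n ωb) - T (x n ωb) with hD
  have hK : 0 ≤ K := (norm_nonneg _).trans (hS 1 S.one_mem)
  have hTK : ‖T‖ ≤ K := by simpa using norm_integral_pow_le (p := p) hLm hS hL 1
  have hDm : ∀ n, Measurable (D n) := fun n =>
    (measurable_apply_of_measurable (hLm.comp (measurable_pi_apply _)) (hxm n)).sub
      (T.continuous.measurable.comp (hxm n))
  have hDC : ∀ n ωb, ‖D n ωb‖ ≤ 2 * K * C := fun n ωb => by
    have h1 := (le_of_opNorm_le _ (hS _ (hL (ωb (n + 1)))) (x n ωb)).trans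
      (mul_le_mul_of_nonneg_left (hxC n ωb) hK)
    have h2 := (le_of_opNorm_le _ hTK (x n ωb)).trans (mul_le_mul_of_nonneg_left (hxC n ωb) hK)
    calc ‖D n ωb‖ ≤ _ := norm_sub_le _ _
      _ ≤ K * C + K * C := add_le_add h1 h2
      _ = 2 * K * C := by ring
  set R : ℕ → (ℕ → Ω) → Evec d := fun N ωb => ∑ n ∈ Finset.range N, D n ωb with hR
  have hRm : ∀ N, Measurable (R N) := fun N => Finset.measurable_fun_sum _ fun n _ => hDm n
  have hRC : ∀ N ωb, ‖R N ωb‖ ≤ N * (2 * K * C) := fun N ωb => by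
    refine (norm_sum_le_of_le _ fun n _ => hDC n ωb).trans_eq ?_
    simp
  have hRu : ∀ N ωb ω, R N (Function.update ωb (N + 1) ω) = R N ωb := fun N ωb ω => by
    refine Finset.sum_congr rfl fun n hn => ?_
    have hnN := Finset.mem_range.1 hn
    simp only [hD]
    rw [hxu n (N + 1) (by omega), Function.update_of_ne (by omega)]
  have hcross : ∀ N, Integrable (fun ωb => inner ℂ (R N ωb) (D N ωb)) μ := fun N => by
    refine Integrable.of_bound ((hRm N).inner (hDm N)).aestronglyMeasurable
      ((N * (2 * K * C)) * (2 * K * C)) (ae_of_all _ fun ωb => ?_)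
    exact (norm_inner_le_norm _ _).trans (mul_le_mul (hRC N ωb) (hDC N ωb) (norm_nonneg _)
      ((norm_nonneg _).trans (hRC N ωb)))
  have hzero : ∀ N, ∫ ωb, inner ℂ (R N ωb) (D N ωb) ∂μ = 0 := fun N => by
    rw [hμ, integral_infinitePi_eq_integral_update (N + 1) (hcross N)]
    refine integral_eq_zero_of_ae (ae_of_all _ fun ωb => ?_)
    simp only [hRu, hD, Function.update_self, hxu N (N + 1) N.lt_succ_self, Pi.zero_apply]
    have hint : Integrable (fun ω => L ω (x N ωb) - T (x N ωb)) p :=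
      ((integrable_of_mem_submonoid hLm hS hL).apply_continuousLinearMap _).sub
        (integrable_const _)
    rw [integral_inner hint, integral_apply_sub_eq_zero (integrable_of_mem_submonoid hLm hS hL),
      inner_zero_right]
  have hRsq : ∀ N, Integrable (fun ωb => ‖R N ωb‖ ^ 2) μ := fun N => by
    refine Integrable.of_bound ((hRm N).norm.pow_const 2).aestronglyMeasurable
      ((N * (2 * K * C)) ^ 2) (ae_of_all _ fun ωb => ?_)
    rw [norm_pow, norm_norm]
    exact pow_le_pow_left₀ (norm_nonneg _) (hRC N ωb) 2
  have hDsq : ∀ n, Integrable (fun ωb => ‖D n ωb‖ ^ 2) μ := fun n => by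
    refine Integrable.of_bound ((hDm n).norm.pow_const 2).aestronglyMeasurable
      ((2 * K * C) ^ 2) (ae_of_all _ fun ωb => ?_)
    rw [norm_pow, norm_norm]
    exact pow_le_pow_left₀ (norm_nonneg _) (hDC n ωb) 2
  refine ae_tendsto_average_zero (fun n => (hDm n).aestronglyMeasurable) hDC fun N => ?_
  change ∫ ωb, ‖R N ωb‖ ^ 2 ∂μ ≤ _
  induction N with
  | zero => simp [hR]
  | succ N ih =>
    have hstep : ∀ ωb, ‖R (N + 1) ωb‖ ^ 2 =
        ‖R N ωb‖ ^ 2 + 2 * RCLike.re (inner ℂ (R N ωb) (D N ωb)) + ‖D N ωb‖ ^ 2 := fun ωb => by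
      have : R (N + 1) ωb = R N ωb + D N ωb := Finset.sum_range_succ _ _
      rw [this]
      exact norm_add_sq _ _
    have hre : ∫ ωb, RCLike.re (inner ℂ (R N ωb) (D N ωb)) ∂μ = 0 := by
      rw [integral_re (hcross N), hzero, map_zero]
    have hDle : ∫ ωb, ‖D N ωb‖ ^ 2 ∂μ ≤ (2 * K * C) ^ 2 := by
      refine (integral_mono (hDsq N) (integrable_const _) fun ωb =>
        pow_le_pow_left₀ (norm_nonneg _) (hDC N ωb) 2).trans_eq ?_
      simp
    simp only [hstep]
    have hsum : Integrable (fun ωb =>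
        ‖R N ωb‖ ^ 2 + 2 * RCLike.re (inner ℂ (R N ωb) (D N ωb))) μ :=
      (hRsq N).add ((hcross N).re.const_mul 2)
    rw [integral_add hsum (hDsq N), integral_add (hRsq N) ((hcross N).re.const_mul 2),
      integral_const_mul, hre]
    push_cast
    linarith

/-- The mean of a random product evolves under the mean operator. -/
lemma integral_random_product (hLm : Measurable L) (hS : ∀ B ∈ S, ‖B‖ ≤ K) (hL : ∀ ω, L ω ∈ S)
    (hxm : ∀ n, Measurable (x n)) (hxC : ∀ n ωb, ‖x n ωb‖ ≤ C)
    (hxu : ∀ n m, n < m → ∀ ωb ω, x n (Function.update ωb m ω) = x n ωb)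
    (hx : ∀ n ωb, x (n + 1) ωb = L (ωb (n + 1)) (x n ωb)) (n : ℕ) :
    ∫ ωb, x n ωb ∂(Measure.infinitePi fun _ : ℕ => p) =
      ((∫ ω, L ω ∂p) ^ n) (∫ ωb, x 0 ωb ∂(Measure.infinitePi fun _ : ℕ => p)) := by
  induction n with
  | zero => simp
  | succ n ih =>
    have hLi : Integrable L p := integrable_of_mem_submonoid hLm hS hL
    rw [integral_infinitePi_eq_integral_update (n + 1)
      (integrable_of_measurable_of_norm_le (hxm _) (hxC _)), pow_succ', mul_apply_eq_comp, ← ih,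
      ← ContinuousLinearMap.integral_comp_comm _
        (integrable_of_measurable_of_norm_le (hxm _) (hxC _))]
    refine integral_congr_ae (ae_of_all _ fun ωb => ?_)
    simp only [hx, Function.update_self, hxu n (n + 1) n.lt_succ_self]
    rw [ContinuousLinearMap.integral_apply hLi]

/-- If the sums of `x` under `x_{n+1} = T x_n + D_n` stay bounded, the noise averages to zero and `T`
has a single fixed point on the affine hyperplane `⟨ψ, ·⟩ = 1`, then `x` averages to it. -/
lemma tendsto_average_of_noise {T : Op d} {ψ t : Evec d} {y : ℕ → Evec d}
    (hT : ∀ v, inner ℂ ψ v = 0 → T v = v → v = 0) (ht : T t = t)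
    (htψ : inner ℂ ψ t = 1) (hy : ∀ n, inner ℂ ψ (y n) = 1)
    (hyC : ∀ n, ‖y n‖ ≤ C)
    (hnoise : Tendsto (fun N : ℕ => (N : ℝ)⁻¹ • ∑ n ∈ Finset.range N, (y (n + 1) - T (y n)))
      atTop (𝓝 0)) :
    Tendsto (fun N : ℕ => (N : ℝ)⁻¹ • ∑ n ∈ Finset.range N, y n) atTop (𝓝 t) := by
  let G : Evec d →L[ℂ] Evec d × ℂ := ((1 : Op d) - T).prod (innerSL ℂ ψ)
  have hG : LinearMap.ker (G : Evec d →ₗ[ℂ] Evec d × ℂ) = ⊥ := by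
    refine LinearMap.ker_eq_bot'.2 fun v hv => ?_
    have h1 : v - T v = 0 := congrArg Prod.fst hv
    have h2 : inner ℂ ψ v = 0 := congrArg Prod.snd hv
    exact hT v h2 (sub_eq_zero.1 h1).symm
  obtain ⟨κ, -, hκ⟩ := LinearMap.exists_antilipschitzWith _ hG
  have hGlim : Tendsto (fun N : ℕ => G ((N : ℝ)⁻¹ • ∑ n ∈ Finset.range N, y n)) atTop
      (𝓝 (G t)) := by
    have hGt : G t = (0, 1) := by
      refine Prod.ext ?_ htψ
      change t - T t = 0
      rw [ht, sub_self]
    rw [hGt]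
    have hbdry : Tendsto (fun N : ℕ => (N : ℝ)⁻¹ • (y 0 - y N)) atTop (𝓝 0) := by
      have hz : Tendsto (fun N : ℕ => (N : ℝ)⁻¹ * (C + C)) atTop (𝓝 0) := by
        simpa using (tendsto_inv_atTop_nhds_zero_nat (𝕜 := ℝ)).mul_const (C + C)
      refine squeeze_zero_norm (fun N => ?_) hz
      rw [norm_smul, norm_inv, Real.norm_natCast]
      exact mul_le_mul_of_nonneg_left ((norm_sub_le _ _).trans (add_le_add (hyC _) (hyC _)))
        (by positivity)
    have hsum := hnoise.add hbdry
    rw [add_zero] at hsum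
    refine Tendsto.prodMk_nhds (hsum.congr fun N => ?_) (tendsto_const_nhds.congr' ?_)
    · change _ = (N : ℝ)⁻¹ • (∑ n ∈ Finset.range N, y n) -
        T ((N : ℝ)⁻¹ • ∑ n ∈ Finset.range N, y n)
      rw [T.map_smul_of_tower, map_sum, ← smul_sub, ← smul_add, Finset.sum_sub_distrib,
        ← neg_sub (y N) (y 0), ← Finset.sum_range_sub y N, Finset.sum_sub_distrib]
      congr 1
      abel
    · filter_upwards [eventually_gt_atTop 0] with N hN
      have hN' : (N : ℂ) ≠ 0 := by exact_mod_cast hN.ne'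
      change 1 = inner ℂ ψ ((N : ℝ)⁻¹ • ∑ n ∈ Finset.range N, y n)
      rw [inner_smul_right_eq_smul, inner_sum, Finset.sum_congr rfl fun n _ => hy n]
      simp [hN']
  rw [tendsto_iff_dist_tendsto_zero] at hGlim ⊢
  refine squeeze_zero (fun _ => dist_nonneg) (fun N => hκ.le_mul_dist _ _) ?_
  simpa using hGlim.const_mul (κ : ℝ)

end RandomProducts

section Semigroup

variable {d : ℕ} {Nrm : Seminorm ℂ (Evec d)} {K : ℝ}

/-- The operators whose adjoints are contractions for a given seminorm. -/
def adjointContractions (Nrm : Seminorm ℂ (Evec d)) : Submonoid (Op d) where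
  carrier := {B | ∀ x, Nrm (adjoint B x) ≤ Nrm x}
  one_mem' x := by rw [← star_eq_adjoint, star_one, one_apply_eq_self]
  mul_mem' {B C} hB hC x := by
    rw [← star_eq_adjoint, star_mul, mul_apply_eq_comp, star_eq_adjoint, star_eq_adjoint]
    exact (hC _).trans (hB x)

lemma adjoint_mem_adjointContractions {B : Op d} (hB : ∀ x, Nrm (B x) ≤ Nrm x) :
    adjoint B ∈ adjointContractions Nrm := fun x => by
  rw [adjoint_adjoint]
  exact hB x

lemma norm_le_of_mem_adjointContractions (hK : ∀ B : Op d, (∀ x, Nrm (B x) ≤ Nrm x) → ‖B‖ ≤ K)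
    {B : Op d} (hB : B ∈ adjointContractions Nrm) : ‖B‖ ≤ K := by
  rw [← LinearIsometryEquiv.norm_map adjoint B]
  exact hK _ hB

lemma seminorm_pow_apply_le {B : Op d} (hB : ∀ x, Nrm (B x) ≤ Nrm x) (n : ℕ) (x : Evec d) :
    Nrm ((B ^ n) x) ≤ Nrm x := by
  induction n with
  | zero => simp
  | succ n ih =>
    rw [pow_succ', mul_apply_eq_comp]
    exact (hB _).trans ih

end Semigroup

section InvariantVector

variable {d : ℕ} {Ω : Type*} [MeasurableSpace Ω] {p : Measure Ω} [IsProbabilityMeasure p]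
  {M : Ω → Op d} {Nrm : Seminorm ℂ (Evec d)} {K : ℝ} {ψS : Evec d}

lemma measurable_adjoint_comp (hM : Measurable M) : Measurable fun ω => adjoint (M ω) :=
  (LinearIsometryEquiv.continuous (adjoint : Op d ≃ₗᵢ⋆[ℂ] Op d)).measurable.comp hM

lemma measurable_psiOf (hM : Measurable M) (hK : ∀ ω n, ‖M ω ^ n‖ ≤ K) :
    Measurable fun ω => psiOf ψS (M ω) := by
  have hC : Measurable fun ω => cesaroProj (M ω) := by
    refine measurable_of_tendsto_metrizable (f := fun (N : ℕ) ω =>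
      (N : ℂ)⁻¹ • ∑ k ∈ Finset.range N, M ω ^ k) (fun N => ?_)
      (tendsto_pi_nhds.2 fun ω => (tendsto_cesaroProj (hK ω)).1)
    exact (by fun_prop : Continuous fun B : Op d =>
      (N : ℂ)⁻¹ • ∑ k ∈ Finset.range N, B ^ k).measurable.comp hM
  exact (ContinuousLinearMap.apply ℂ (Evec d) ψS).continuous.measurable.comp
    (measurable_adjoint_comp hC)

lemma inner_psiOf {A : Op d} (hA : ∀ n, ‖A ^ n‖ ≤ K) (hfix : A ψS = ψS) (hψS : ‖ψS‖ = 1) :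
    inner ℂ ψS (psiOf ψS A) = 1 := by
  rw [psiOf, adjoint_inner_right, cesaroProj_apply_of_fixed hA hfix, inner_self_eq_norm_sq_to_K,
    hψS]
  simp

lemma norm_psiOf_le {A : Op d} (hA : ∀ n, ‖A ^ n‖ ≤ K) (hψS : ‖ψS‖ = 1) : ‖psiOf ψS A‖ ≤ K := by
  have h := le_of_opNorm_le (adjoint (cesaroProj A)) (c := K)
    (by rw [LinearIsometryEquiv.norm_map]; exact norm_cesaroProj_le hA) ψS
  rwa [hψS, mul_one] at h

lemma inner_adjoint_apply_of_fixed {A : Op d} (hfix : A ψS = ψS) (v : Evec d) :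
    inner ℂ ψS (adjoint A v) = inner ℂ ψS v := by
  rw [adjoint_inner_right, hfix]

lemma adjoint_apply_psiOf {A : Op d} (hA : ∀ n, ‖A ^ n‖ ≤ K) :
    adjoint A (psiOf ψS A) = psiOf ψS A := by
  conv_rhs => rw [psiOf, ← (tendsto_cesaroProj hA).2.2]
  rw [← star_eq_adjoint, ← star_eq_adjoint, star_mul, mul_apply_eq_comp]
  rfl

/-- If the powers of `A*` vanish on the orthogonal complement of `ψS`, they converge to `psiOf ψS A`
on the affine hyperplane `⟨ψS, ·⟩ = 1`. -/
lemma tendsto_adjoint_pow_apply {A : Op d} (hA : ∀ n, ‖A ^ n‖ ≤ K) (hfix : A ψS = ψS)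
    (hψS : ‖ψS‖ = 1)
    (hW : ∀ v, inner ℂ ψS v = 0 → Tendsto (fun n : ℕ => (adjoint A ^ n) v) atTop (𝓝 0))
    {u : Evec d} (hu : inner ℂ ψS u = 1) :
    Tendsto (fun n : ℕ => (adjoint A ^ n) u) atTop (𝓝 (psiOf ψS A)) := by
  have hpow : ∀ n : ℕ, (adjoint A ^ n) (psiOf ψS A) = psiOf ψS A := fun n => by
    induction n with
    | zero => simp
    | succ n ih => rw [pow_succ, mul_apply_eq_comp, adjoint_apply_psiOf hA, ih]
  have h := (hW (u - psiOf ψS A) (by rw [inner_sub_right, hu, inner_psiOf hA hfix hψS,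
    sub_self])).add_const (psiOf ψS A)
  rw [zero_add] at h
  refine h.congr fun n => ?_
  rw [map_sub, hpow, sub_add_cancel]

lemma adjoint_cesaroProj_apply_eq_zero {A : Op d} (hA : ∀ n, ‖A ^ n‖ ≤ K) {v : Evec d}
    (hv : Tendsto (fun n : ℕ => (adjoint A ^ n) v) atTop (𝓝 0)) :
    adjoint (cesaroProj A) v = 0 := by
  have hstep : adjoint (cesaroProj A) * adjoint A = adjoint (cesaroProj A) := by
    rw [← star_eq_adjoint, ← star_eq_adjoint, ← star_mul, (tendsto_cesaroProj hA).2.1]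
  have hpow : ∀ n : ℕ, adjoint (cesaroProj A) * adjoint A ^ n = adjoint (cesaroProj A) :=
    fun n => by
      induction n with
      | zero => simp
      | succ n ih => rw [pow_succ', ← mul_assoc, hstep, ih]
  have h := ((adjoint (cesaroProj A)).continuous.tendsto 0).comp hv
  rw [map_zero] at h
  refine tendsto_nhds_unique (tendsto_const_nhds.congr fun n => ?_) h
  rw [Function.comp_apply, ← mul_apply_eq_comp, hpow]

/-- Under a positive-probability `ℳ_(E)` condition the averaged adjoint dynamics contracts the
orthogonal complement of the invariant vector. -/
lemma tendsto_adjoint_integral_pow_apply (hM : Measurable M) (hNrm : ∀ x, Nrm x = 0 → x = 0)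
    (hcontr : ∀ ω x, Nrm (M ω x) ≤ Nrm x) (hψS : ψS ≠ 0) (hfix : ∀ ω, M ω ψS = ψS)
    (hpos : 0 < p {ω | mcalE ψS (M ω)}) {v : Evec d} (hv : inner ℂ ψS v = 0) :
    Tendsto (fun n : ℕ => ((∫ ω, adjoint (M ω) ∂p) ^ n) v) atTop (𝓝 0) := by
  obtain ⟨K, -, hK⟩ := exists_opNorm_le_of_contraction Nrm hNrm
  have hLm := measurable_adjoint_comp hM
  have hS : ∀ B ∈ adjointContractions Nrm, ‖B‖ ≤ K := fun B hB =>
    norm_le_of_mem_adjointContractions hK hB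
  have hL : ∀ ω, adjoint (M ω) ∈ adjointContractions Nrm := fun ω =>
    adjoint_mem_adjointContractions (hcontr ω)
  have hLi := integrable_of_mem_submonoid (p := p) hLm hS hL
  have hs : (p.map M) {B | mcalE ψS B ∧ ∀ x, Nrm (B x) ≤ Nrm x} ≠ 0 := by
    refine (hpos.trans_le (le_trans (measure_mono fun ω hω => ?_)
      (Measure.le_map_apply hM.aemeasurable _))).ne'
    exact ⟨hω, hcontr ω⟩
  obtain ⟨M₀, ⟨hE, hM₀⟩, hnhds⟩ := exists_mem_forall_mem_nhdsWithin_pos_measure hs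
  have hM₀K : ∀ n : ℕ, ‖M₀ ^ n‖ ≤ K := fun n => hK _ (seminorm_pow_apply_le hM₀ n)
  refine tendsto_integral_pow_apply hLm hS hL (W := {v | inner ℂ ψS v = 0}) (fun w hw => ?_)
    (L₀ := adjoint M₀) (fun ε hε => exists_norm_adjoint_pow_apply_le hψS hM₀K hE hε)
    (fun U hU => ?_) hv
  · change inner ℂ ψS ((∫ ω, adjoint (M ω) ∂p) w) = 0
    have hw' : inner ℂ ψS w = 0 := hw
    rw [ContinuousLinearMap.integral_apply hLi,
      ← integral_inner (hLi.apply_continuousLinearMap w)]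
    simp only [inner_adjoint_apply_of_fixed (hfix _), hw', integral_zero]
  · obtain ⟨V, hVU, hV, hM₀V⟩ := mem_nhds_iff.1 ((LinearIsometryEquiv.continuous
      (adjoint : Op d ≃ₗᵢ⋆[ℂ] Op d)).continuousAt.preimage_mem_nhds hU)
    have h := hnhds V (mem_nhdsWithin_of_mem_nhds (hV.mem_nhds hM₀V))
    rw [Measure.map_apply hM hV.measurableSet] at h
    exact h.trans_le (measure_mono fun ω hω => hVU hω)

end InvariantVector

/-- Fluctuating process: almost surely `(1/N) Σ_{n=1}^N θ_n(ω̄) → θ`, where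
`θ = P_{1,E[M]}^* ψ_S = lim E[θ_n] = P_{1,E[M]}^* E[ψ]`.  Here `ω̄ = (ω̄ 0, ω̄ 1, …)` stands
for `(ω_1, ω_2, …)` and `θ_n(ω̄) = M(ω_n)^* ⋯ M(ω_2)^* ψ(ω_1)`. -/
theorem stmt12 {d : ℕ} (hd : 1 ≤ d) {Ω : Type*} [MeasurableSpace Ω]
    (p : Measure Ω) [IsProbabilityMeasure p]
    (M : Ω → Op d) (hMmeas : Measurable M)
    (Nrm : Seminorm ℂ (Evec d)) (hNrm : ∀ x, Nrm x = 0 → x = 0)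
    (hcontr : ∀ (ω : Ω) (x : Evec d), Nrm (M ω x) ≤ Nrm x)
    (ψS : Evec d) (hψS : ‖ψS‖ = 1) (hfix : ∀ ω, M ω ψS = ψS)
    (Pb : Measure (ℕ → Ω)) [IsProbabilityMeasure Pb]
    (hPb : ∀ n : ℕ, Pb.map (fun ωb (i : Fin n) => ωb i) = Measure.pi fun _ : Fin n => p)
    (hpos : 0 < p {ω | mcalE ψS (M ω)})
    (θ : ℕ → (ℕ → Ω) → Evec d)
    (hθ : ∀ (n : ℕ) (ωb : ℕ → Ω), θ n ωb =
      ((List.ofFn fun i : Fin (n - 1) => adjoint (M (ωb (n - 1 - i)))).prod)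
        (psiOf ψS (M (ωb 0)))) :
    ∃ Ω₂ : Set (ℕ → Ω), Pb Ω₂ = 1 ∧
      (∀ ωb ∈ Ω₂,
        Tendsto (fun N : ℕ => (N : ℝ)⁻¹ • ∑ n ∈ Finset.range N, θ (n + 1) ωb) atTop
          (nhds (adjoint (cesaroProj (∫ ω, M ω ∂p)) ψS))) ∧
      Tendsto (fun n : ℕ => ∫ ωb, θ n ωb ∂Pb) atTop
        (nhds (adjoint (cesaroProj (∫ ω, M ω ∂p)) ψS)) ∧
      adjoint (cesaroProj (∫ ω, M ω ∂p)) ψS =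
        adjoint (cesaroProj (∫ ω, M ω ∂p)) (∫ ω, psiOf ψS (M ω) ∂p) := by
  have hP : Pb = Measure.infinitePi fun _ : ℕ => p := eq_infinitePi_of_map_fin hPb
  have hψ0 : ψS ≠ 0 := norm_ne_zero_iff.1 (by rw [hψS]; exact one_ne_zero)
  obtain ⟨K, hK0, hK⟩ := exists_opNorm_le_of_contraction Nrm hNrm
  have hMK : ∀ ω (n : ℕ), ‖M ω ^ n‖ ≤ K := fun ω n => hK _ (seminorm_pow_apply_le (hcontr ω) n)
  have hLm := measurable_adjoint_comp hMmeas
  have hS : ∀ B ∈ adjointContractions Nrm, ‖B‖ ≤ K := fun B hB =>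
    norm_le_of_mem_adjointContractions hK hB
  have hL : ∀ ω, adjoint (M ω) ∈ adjointContractions Nrm := fun ω =>
    adjoint_mem_adjointContractions (hcontr ω)
  have hMi : Integrable M p := Integrable.of_bound hMmeas.aestronglyMeasurable K
    (ae_of_all _ fun ω => hK _ (hcontr ω))
  set A := ∫ ω, M ω ∂p with hA
  have hT : ∫ ω, adjoint (M ω) ∂p = adjoint A := integral_adjoint hMi
  have hAK : ∀ n : ℕ, ‖A ^ n‖ ≤ K := fun n => by
    rw [← LinearIsometryEquiv.norm_map adjoint (A ^ n), ← adjoint_pow, ← hT]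
    exact norm_integral_pow_le hLm hS hL n
  have hAfix : A ψS = ψS := by
    rw [hA, ContinuousLinearMap.integral_apply hMi]
    simp [hfix]
  have hW : ∀ v, inner ℂ ψS v = 0 → Tendsto (fun n : ℕ => (adjoint A ^ n) v) atTop (𝓝 0) :=
    fun v hv => by
      rw [← hT]
      exact tendsto_adjoint_integral_pow_apply hMmeas hNrm hcontr hψ0 hfix hpos hv
  have hψm : Measurable fun ω => psiOf ψS (M ω) := measurable_psiOf hMmeas hMK
  have hψi : Integrable (fun ω => psiOf ψS (M ω)) p :=
    integrable_of_measurable_of_norm_le hψm fun ω => norm_psiOf_le (hMK ω) hψS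
  have hψmean : inner ℂ ψS (∫ ω, psiOf ψS (M ω) ∂p) = 1 := by
    rw [← integral_inner hψi]
    simp [fun ω => inner_psiOf (hMK ω) (hfix ω) hψS]
  have hx0 : ∀ ωb, θ 1 ωb = psiOf ψS (M (ωb 0)) := fun ωb => by simp [hθ]
  have hx : ∀ n ωb, θ (n + 1 + 1) ωb = adjoint (M (ωb (n + 1))) (θ (n + 1) ωb) := fun n ωb => by
    rw [hθ, hθ, Nat.add_sub_cancel, Nat.add_sub_cancel, List.ofFn_succ, List.prod_cons,
      mul_apply_eq_comp]
    simp only [Fin.val_zero, Nat.sub_zero, Fin.val_succ, Nat.add_sub_add_right]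
  have hxm : ∀ n, Measurable (θ (n + 1)) := fun n => by
    induction n with
    | zero =>
      rw [funext hx0]
      exact hψm.comp (measurable_pi_apply 0)
    | succ n ih =>
      rw [funext (hx n)]
      exact measurable_apply_of_measurable (hLm.comp (measurable_pi_apply _)) ih
  have hxC : ∀ n ωb, ‖θ (n + 1) ωb‖ ≤ K * K := fun n ωb => by
    obtain ⟨B, hB, hBx⟩ : ∃ B ∈ adjointContractions Nrm,
        θ (n + 1) ωb = B (psiOf ψS (M (ωb 0))) :=
      ⟨_, Submonoid.list_prod_mem _ (by simpa [List.forall_mem_ofFn_iff] using fun _ => hL _),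
        hθ _ _⟩
    rw [hBx]
    exact (le_of_opNorm_le _ (hS B hB) _).trans
      (mul_le_mul_of_nonneg_left (norm_psiOf_le (hMK _) hψS) hK0)
  have hxu : ∀ n m, n < m → ∀ ωb ω, θ (n + 1) (Function.update ωb m ω) = θ (n + 1) ωb := by
    intro n m hnm ωb ω
    induction n with
    | zero => rw [hx0, hx0, Function.update_of_ne hnm.ne]
    | succ n ih => rw [hx, hx, ih (by omega), Function.update_of_ne hnm.ne]
  have hxψ : ∀ n ωb, inner ℂ ψS (θ (n + 1) ωb) = 1 := fun n ωb => by
    induction n with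
    | zero => rw [hx0, inner_psiOf (hMK _) (hfix _) hψS]
    | succ n ih => rw [hx, inner_adjoint_apply_of_fixed (hfix _), ih]
  have hnoise := ae_tendsto_average_noise (p := p) (x := fun n => θ (n + 1)) hLm hS hL hxm hxC hxu
  rw [← hP, hT] at hnoise
  refine ⟨{ωb | Tendsto (fun N : ℕ => (N : ℝ)⁻¹ • ∑ n ∈ Finset.range N, θ (n + 1) ωb) atTop
    (𝓝 (psiOf ψS A))}, ?_, fun ωb hωb => hωb, ?_, ?_⟩
  · rw [← measure_univ (μ := Pb)]
    refine measure_congr (eventuallyEq_univ.2 (hnoise.mono fun ωb h => ?_))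
    refine tendsto_average_of_noise (T := adjoint A) (ψ := ψS) (C := K * K) (fun v hv hTv => ?_)
      (adjoint_apply_psiOf hAK) (inner_psiOf hAK hAfix hψS) (fun n => hxψ n ωb)
      (fun n => hxC n ωb) ?_
    · refine tendsto_nhds_unique (tendsto_const_nhds.congr fun n => ?_) (hW v hv)
      induction n with
      | zero => simp
      | succ n ih => rw [pow_succ, mul_apply_eq_comp, hTv, ← ih]
    · simpa only [hx] using h
  · refine (tendsto_add_atTop_iff_nat 1).1 ((tendsto_adjoint_pow_apply hAK hAfix hψS hW
      hψmean).congr fun n => ?_)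
    have h0 : ∫ ωb, θ 1 ωb ∂Pb = ∫ ω, psiOf ψS (M ω) ∂p := by
      simp only [hx0]
      rw [hP, ← Measure.infinitePi_map_eval (fun _ : ℕ => p) 0, integral_map
        (measurable_pi_apply 0).aemeasurable hψm.aestronglyMeasurable]
      simp only [Measure.infinitePi_map_eval]
    have h1 := integral_random_product (p := p) (x := fun n => θ (n + 1)) hLm hS hL hxm hxC hxu hx n
    rw [← hP, hT] at h1
    rw [h1, ← h0]
  · rw [← sub_eq_zero, ← map_sub]
    refine adjoint_cesaroProj_apply_eq_zero hAK (hW _ ?_)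
    rw [inner_sub_right, hψmean, inner_self_eq_norm_sq_to_K, hψS]
    simp
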